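/- arXiv:2202.12642 — 2 statements merged into one kernel-verified Lean document; each statement's English description precedes it below -/
import Mathlib

section
/- Let γ̄_S, γ̄_R > 0 and let X, Y be independent random variables, X exponential with mean γ̄_S and Y exponential with mean γ̄_R. Then for every ζ > 0, P( X/(Y + 1) ≤ ζ ) = 1 − e^{−ζ/γ̄_S} / (1 + (γ̄_R/γ̄_S) · ζ). -/
open MeasureTheory ProbabilityTheory Real Filter Finset

/-- `X` is exponentially distributed with mean `γ` under `μ`:
`P(X > x) = exp (-x/γ)` for all `x ≥ 0`. -/
def IsExpMean {Ω : Type*} [MeasurableSpace Ω] (μ : Measure Ω) (X : Ω → ℝ) (γ : ℝ) : Prop :=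
  ∀ x : ℝ, 0 ≤ x → μ {ω | x < X ω} = ENNReal.ofReal (Real.exp (-x / γ))

lemma IsExpMean.map_eq_expMeasure {Ω : Type*} [MeasurableSpace Ω] {μ : Measure Ω}
    [IsProbabilityMeasure μ] {X : Ω → ℝ} {γ : ℝ} (hγ : 0 < γ) (hXm : Measurable X)
    (hX : IsExpMean μ X γ) : μ.map X = expMeasure γ⁻¹ := by
  have hr : 0 < γ⁻¹ := inv_pos.2 hγ
  have : IsProbabilityMeasure (μ.map X) := Measure.isProbabilityMeasure_map hXm.aemeasurable
  have : IsProbabilityMeasure (expMeasure γ⁻¹) := isProbabilityMeasure_expMeasure hr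
  have hcdf : ∀ x : ℝ, 0 ≤ x → cdf (μ.map X) x = 1 - Real.exp (-x / γ) := by
    intro x hx
    have htail : (μ.map X).real (Set.Ioi x) = Real.exp (-x / γ) := by
      rw [measureReal_def, Measure.map_apply hXm measurableSet_Ioi]
      change (μ {ω | x < X ω}).toReal = _
      rw [hX x hx, ENNReal.toReal_ofReal (Real.exp_nonneg _)]
    have := probReal_compl_eq_one_sub (μ := μ.map X) (measurableSet_Iic (a := x))
    rw [Set.compl_Iic, htail] at this
    rw [cdf_eq_real]
    linarith
  apply Measure.eq_of_cdf
  ext x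
  rw [cdf_expMeasure_eq hr]
  split_ifs with hx
  · rw [hcdf x hx]
    ring_nf
  · refine le_antisymm ?_ (cdf_nonneg _ _)
    calc cdf (μ.map X) x ≤ cdf (μ.map X) 0 := monotone_cdf _ (not_le.1 hx).le
      _ = 0 := by simp [hcdf 0 le_rfl]

lemma ae_nonneg_expMeasure (r : ℝ) : ∀ᵐ y ∂expMeasure r, 0 ≤ y := by
  have h : expMeasure r (Set.Iio 0) = 0 := by
    change (volume.withDensity (exponentialPDF r)) (Set.Iio 0) = 0
    rw [withDensity_apply _ measurableSet_Iio]
    exact lintegral_exponentialPDF_of_nonpos le_rfl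
  rw [ae_iff]
  simpa [Set.Iio] using h

lemma lintegral_exp_neg_mul_expMeasure {r s : ℝ} (hr : 0 < r) (hs : 0 < s) :
    ∫⁻ y, ENNReal.ofReal (Real.exp (-(s * y))) ∂expMeasure r = ENNReal.ofReal (r / (r + s)) := by
  have hrs : 0 < r + s := add_pos hr hs
  have hmeas (t : ℝ) : Measurable (exponentialPDF t) :=
    (measurable_exponentialPDFReal t).ennreal_ofReal
  change ∫⁻ y, _ ∂(volume.withDensity (exponentialPDF r)) = _
  rw [lintegral_withDensity_eq_lintegral_mul _ (hmeas r) (by fun_prop)]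
  calc ∫⁻ y, (exponentialPDF r * fun y ↦ ENNReal.ofReal (Real.exp (-(s * y)))) y
      = ∫⁻ y, ENNReal.ofReal (r / (r + s)) * exponentialPDF (r + s) y := by
        congr with y
        rw [Pi.mul_apply]
        rcases lt_or_ge y 0 with hy | hy
        · simp [exponentialPDF_of_neg hy]
        · rw [exponentialPDF_of_nonneg hy, exponentialPDF_of_nonneg hy,
            ← ENNReal.ofReal_mul (by positivity), ← ENNReal.ofReal_mul (by positivity),
            mul_assoc, ← Real.exp_add, ← mul_assoc, div_mul_cancel₀ _ hrs.ne']
          ring_nf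
    _ = ENNReal.ofReal (r / (r + s)) := by
        rw [lintegral_const_mul _ (hmeas _), lintegral_exponentialPDF_eq_one hrs, mul_one]

lemma measure_mul_add_one_lt {Ω : Type*} [MeasurableSpace Ω] {μ : Measure Ω}
    [IsProbabilityMeasure μ] {γS γR : ℝ} (hγS : 0 < γS) (hγR : 0 < γR) {X Y : Ω → ℝ}
    (hXm : Measurable X) (hYm : Measurable Y) (hX : IsExpMean μ X γS) (hY : IsExpMean μ Y γR)
    (hindep : IndepFun X Y μ) {ζ : ℝ} (hζ : 0 < ζ) :
    μ {ω | ζ * (Y ω + 1) < X ω} =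
      ENNReal.ofReal (Real.exp (-ζ / γS) / (1 + (γR / γS) * ζ)) := by
  have : IsProbabilityMeasure (μ.map X) := Measure.isProbabilityMeasure_map hXm.aemeasurable
  have hS : MeasurableSet {p : ℝ × ℝ | ζ * (p.1 + 1) < p.2} :=
    measurableSet_lt (by fun_prop) (by fun_prop)
  calc μ {ω | ζ * (Y ω + 1) < X ω}
      = (μ.map fun ω ↦ (Y ω, X ω)) {p : ℝ × ℝ | ζ * (p.1 + 1) < p.2} := by
        rw [Measure.map_apply (hYm.prodMk hXm) hS]; rfl
    _ = ∫⁻ y, μ.map X (Set.Ioi (ζ * (y + 1))) ∂expMeasure γR⁻¹ := by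
        rw [(indepFun_iff_map_prod_eq_prod_map_map hYm.aemeasurable hXm.aemeasurable).1
          hindep.symm, Measure.prod_apply hS, hY.map_eq_expMeasure hγR hYm]
        rfl
    _ = ∫⁻ y, ENNReal.ofReal (Real.exp (-ζ / γS)) *
          ENNReal.ofReal (Real.exp (-(ζ / γS * y))) ∂expMeasure γR⁻¹ := by
        refine lintegral_congr_ae ?_
        filter_upwards [ae_nonneg_expMeasure γR⁻¹] with y hy
        rw [Measure.map_apply hXm measurableSet_Ioi, ← ENNReal.ofReal_mul (Real.exp_nonneg _),
          ← Real.exp_add]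
        refine (hX _ (by positivity)).trans ?_
        ring_nf
    _ = ENNReal.ofReal (Real.exp (-ζ / γS) / (1 + (γR / γS) * ζ)) := by
        rw [lintegral_const_mul _ (by fun_prop),
          lintegral_exp_neg_mul_expMeasure (inv_pos.2 hγR) (div_pos hζ hγS),
          ← ENNReal.ofReal_mul (Real.exp_nonneg _)]
        congr 1
        field_simp

theorem stmt_1 {Ω : Type*} [MeasurableSpace Ω] (μ : Measure Ω) [IsProbabilityMeasure μ]
    (γS γR : ℝ) (hγS : 0 < γS) (hγR : 0 < γR)
    (X Y : Ω → ℝ) (hXm : Measurable X) (hYm : Measurable Y)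
    (hX : IsExpMean μ X γS) (hY : IsExpMean μ Y γR)
    (hindep : IndepFun X Y μ)
    (ζ : ℝ) (hζ : 0 < ζ) :
    μ {ω | X ω / (Y ω + 1) ≤ ζ} =
      ENNReal.ofReal (1 - Real.exp (-ζ / γS) / (1 + (γR / γS) * ζ)) := by
  have hYpos : ∀ᵐ ω ∂μ, 0 ≤ Y ω := by
    refine ae_of_ae_map hYm.aemeasurable ?_
    rw [hY.map_eq_expMeasure hγR hYm]
    exact ae_nonneg_expMeasure γR⁻¹
  have hcompl : μ {ω | X ω / (Y ω + 1) ≤ ζ} = μ {ω | ζ * (Y ω + 1) < X ω}ᶜ := by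
    refine measure_congr ?_
    filter_upwards [hYpos] with ω hω
    refine propext ?_
    change X ω / (Y ω + 1) ≤ ζ ↔ ¬ ζ * (Y ω + 1) < X ω
    rw [div_le_iff₀ (by linarith), not_lt]
  rw [hcompl, prob_compl_eq_one_sub (measurableSet_lt (by fun_prop) hXm),
    measure_mul_add_one_lt hγS hγR hXm hYm hX hY hindep hζ,
    ENNReal.ofReal_sub _ (by positivity), ENNReal.ofReal_one]
end

section
/- For every integer N ≥ 1 and every real a > 0, 1 − N · Σ_{p=0}^{N−1} (−1)^p · C(N−1, p) / ( (p+1) · (1 + (p+1)·a) ) = N! · a^N / ∏_{p=1}^{N} (1 + p·a). -/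
open Finset

/-- Pascal's rule for alternating binomial sums. -/
theorem sum_range_alternating_choose_succ (n : ℕ) (f : ℕ → ℝ) :
    ∑ p ∈ range (n + 2), (-1 : ℝ) ^ p * (n + 1).choose p * f p =
      ∑ p ∈ range (n + 1), (-1 : ℝ) ^ p * n.choose p * f p -
        ∑ p ∈ range (n + 1), (-1 : ℝ) ^ p * n.choose p * f (p + 1) := by
  have h : ∑ p ∈ range (n + 1), (-1 : ℝ) ^ p * n.choose p * f p =
      ∑ p ∈ range (n + 2), (-1 : ℝ) ^ p * n.choose p * f p := by
    rw [sum_range_succ _ (n + 1)]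
    simp
  rw [h, sum_range_succ', sum_range_succ' _ (n + 1), add_sub_right_comm, ← sum_sub_distrib]
  congr 1
  · refine sum_congr rfl fun p _ => ?_
    rw [Nat.choose_succ_succ]
    push_cast
    ring
  · simp

/-- Partial fractions for the reciprocal of a product over an arithmetic progression. -/
theorem sum_range_alternating_choose_div (n : ℕ) {a c : ℝ} (ha : 0 < a) (hc : 0 < c) :
    ∑ p ∈ range (n + 1), (-1 : ℝ) ^ p * n.choose p * (c + p * a)⁻¹ =
      n.factorial * a ^ n / ∏ p ∈ range (n + 1), (c + p * a) := by
  induction n generalizing c with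
  | zero => simp
  | succ n ih =>
    have hpos (d : ℝ) (hd : 0 < d) : 0 < ∏ p ∈ range (n + 1), (d + p * a) :=
      prod_pos fun p _ => by positivity
    have hshift (p : ℕ) : c + ((p + 1 : ℕ) : ℝ) * a = (c + a) + p * a := by push_cast; ring
    have hprod : (∏ p ∈ range (n + 1), (c + p * a)) * (c + ((n + 1 : ℕ) : ℝ) * a) =
        (∏ p ∈ range (n + 1), ((c + a) + p * a)) * c := by
      rw [← prod_range_succ (fun p : ℕ => c + (p : ℝ) * a), prod_range_succ']
      simp only [hshift]
      simp
    have hca : 0 < c + a := by positivity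
    have hlast : 0 < c + ((n + 1 : ℕ) : ℝ) * a := by positivity
    rw [sum_range_alternating_choose_succ n fun p => (c + (p : ℝ) * a)⁻¹]
    simp only [hshift]
    rw [ih hc, ih hca, prod_range_succ _ (n + 1), Nat.factorial_succ]
    have h₁ := hpos c hc
    have h₂ := hpos (c + a) hca
    generalize ∏ p ∈ range (n + 1), (c + (p : ℝ) * a) = P at *
    generalize ∏ p ∈ range (n + 1), (c + a + (p : ℝ) * a) = Q at *
    obtain rfl : Q = P * (c + ((n + 1 : ℕ) : ℝ) * a) / c := by
      rw [eq_div_iff hc.ne', hprod]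
    push_cast at hlast ⊢
    field_simp
    ring

theorem stmt_8 (N : ℕ) (hN : 1 ≤ N) (a : ℝ) (ha : 0 < a) :
    1 - N * ∑ p ∈ Finset.range N, (-1 : ℝ) ^ p * (N - 1).choose p /
        (((p : ℝ) + 1) * (1 + ((p : ℝ) + 1) * a)) =
      (N.factorial : ℝ) * a ^ N / ∏ p ∈ Finset.Icc 1 N, (1 + (p : ℝ) * a) := by
  obtain ⟨n, rfl⟩ := Nat.exists_eq_add_of_le' hN
  have hprod : ∏ p ∈ Icc 1 (n + 1), (1 + (p : ℝ) * a) =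
      ∏ p ∈ range (n + 1 + 1), (1 + (p : ℝ) * a) := by
    rw [prod_range_succ', ← Ico_add_one_right_eq_Icc, prod_Ico_eq_prod_range]
    simp [add_comm]
  rw [hprod, ← sum_range_alternating_choose_div (n + 1) ha one_pos, sum_range_succ' _ (n + 1),
    mul_sum, sub_eq_neg_add, ← sum_neg_distrib]
  congr 1
  · refine sum_congr rfl fun p _ => ?_
    have hchoose : ((n : ℝ) + 1) * n.choose p = (n + 1).choose (p + 1) * ((p : ℝ) + 1) := by
      exact_mod_cast Nat.add_one_mul_choose_eq n p
    have hden : 0 < 1 + ((p : ℝ) + 1) * a := by positivity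
    have hp : 0 < (p : ℝ) + 1 := by positivity
    push_cast
    rw [pow_succ]
    field_simp
    linear_combination -hchoose
  · simp
end
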